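/- Let v ∈ ℂ^N, β > 0, and let E be an N×N real diagonal positive semidefinite matrix with eigenvalues (diagonal entries) sorted decreasingly e_1 ≥ e_2 ≥ … ≥ e_N ≥ 0. Let λ_1 ≥ λ_2 ≥ … ≥ λ_N be the eigenvalues of the Hermitian matrix B = v v^H − β E, sorted decreasingly. Then ‖v‖² − β e_1 ≤ λ_1 ≤ ‖v‖² − β e_N, and for every i with 2 ≤ i ≤ N, −β e_{N−i+1} ≤ λ_i ≤ −β e_{N−i+2}. -/

import Mathlib

open Matrix ComplexOrder

open scoped InnerProductSpace

/-- Fewer linear functionals than the dimension have a common nonzero zero. -/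
lemma exists_ne_zero_forall_dual_eq_zero {K V ι : Type*} [Field K] [AddCommGroup V] [Module K V]
    [FiniteDimensional K V] [Fintype ι] (f : ι → Module.Dual K V)
    (h : Fintype.card ι < Module.finrank K V) : ∃ x ≠ 0, ∀ i, f i x = 0 := by
  have hker : LinearMap.ker (LinearMap.pi f) ≠ ⊥ :=
    LinearMap.ker_ne_bot_of_finrank_lt (by simpa using h)
  obtain ⟨x, hx, hx0⟩ := (Submodule.ne_bot_iff _).mp hker
  exact ⟨x, hx0, fun i => congrFun (LinearMap.mem_ker.mp hx) i⟩

section EigenvectorBasis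

variable {ι V : Type*} [Fintype ι] [NormedAddCommGroup V] [InnerProductSpace ℂ V]

/-- The quadratic form of an operator in the coordinates of an orthonormal eigenbasis. -/
lemma OrthonormalBasis.re_inner_apply_eq_sum (b : OrthonormalBasis ι ℂ V) {T : V →ₗ[ℂ] V}
    {μ : ι → ℝ} (hT : ∀ j, T (b j) = (μ j : ℂ) • b j) (x : V) :
    (⟪x, T x⟫_ℂ).re = ∑ j, μ j * ‖⟪b j, x⟫_ℂ‖ ^ 2 := by
  conv_lhs => rw [← b.sum_repr' x, map_sum, b.sum_repr' x, inner_sum, Complex.re_sum]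
  refine Finset.sum_congr rfl fun j _ => ?_
  rw [map_smul, hT, inner_smul_right, inner_smul_right, ← inner_conj_symm x (b j), mul_left_comm,
    Complex.mul_conj, Complex.normSq_eq_norm_sq, ← Complex.ofReal_mul, Complex.ofReal_re]

lemma sum_mul_sq_norm_le {c : ℝ} {μ : ι → ℝ} {z : ι → ℂ} (h : ∀ j, z j ≠ 0 → μ j ≤ c) :
    ∑ j, μ j * ‖z j‖ ^ 2 ≤ c * ∑ j, ‖z j‖ ^ 2 := by
  rw [Finset.mul_sum]
  refine Finset.sum_le_sum fun j _ => ?_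
  by_cases hz : z j = 0
  · simp [hz]
  · exact mul_le_mul_of_nonneg_right (h j hz) (by positivity)

lemma le_sum_mul_sq_norm {c : ℝ} {μ : ι → ℝ} {z : ι → ℂ} (h : ∀ j, z j ≠ 0 → c ≤ μ j) :
    c * ∑ j, ‖z j‖ ^ 2 ≤ ∑ j, μ j * ‖z j‖ ^ 2 := by
  rw [Finset.mul_sum]
  refine Finset.sum_le_sum fun j _ => ?_
  by_cases hz : z j = 0
  · simp [hz]
  · exact mul_le_mul_of_nonneg_right (h j hz) (by positivity)

end EigenvectorBasis

/-- The quadratic form of `v v^H − β E`. -/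
lemma re_inner_rank_one_sub_diagonal {n : Type*} [Fintype n] [DecidableEq n]
    (v : n → ℂ) (β : ℝ) (e : n → ℝ) (x : EuclideanSpace ℂ n) :
    (⟪x, Matrix.toEuclideanLin (Matrix.vecMulVec v (star v) -
        ((β : ℝ) : ℂ) • Matrix.diagonal (fun i => ((e i : ℝ) : ℂ))) x⟫_ℂ).re =
      ‖⟪WithLp.toLp 2 v, x⟫_ℂ‖ ^ 2 - β * ∑ j, e j * ‖x j‖ ^ 2 := by
  have h1 : ⟪x, WithLp.toLp 2 (Matrix.vecMulVec v (star v) *ᵥ x.ofLp)⟫_ℂ =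
      ((‖⟪WithLp.toLp 2 v, x⟫_ℂ‖ ^ 2 : ℝ) : ℂ) := by
    have : WithLp.toLp 2 (Matrix.vecMulVec v (star v) *ᵥ x.ofLp) =
        ⟪WithLp.toLp 2 v, x⟫_ℂ • WithLp.toLp 2 v := by
      ext i
      simp [Matrix.vecMulVec_mulVec, EuclideanSpace.inner_eq_star_dotProduct, dotProduct_comm,
        mul_comm]
    rw [this, inner_smul_right, ← inner_conj_symm x, Complex.mul_conj, Complex.normSq_eq_norm_sq]
  have h2 : ⟪x, WithLp.toLp 2 (Matrix.diagonal (fun i => ((e i : ℝ) : ℂ)) *ᵥ x.ofLp)⟫_ℂ =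
      ((∑ j, e j * ‖x j‖ ^ 2 : ℝ) : ℂ) := by
    rw [PiLp.inner_apply, Complex.ofReal_sum]
    refine Finset.sum_congr rfl fun j _ => ?_
    change ⟪x j, (Matrix.diagonal _ *ᵥ x.ofLp) j⟫_ℂ = _
    rw [Matrix.mulVec_diagonal, RCLike.inner_apply, mul_assoc, Complex.mul_conj,
      Complex.normSq_eq_norm_sq, Complex.ofReal_mul]
  rw [Matrix.toLpLin_apply, Matrix.sub_mulVec, Matrix.smul_mulVec, WithLp.toLp_sub,
    WithLp.toLp_smul, inner_sub_right, inner_smul_right, h1, h2, ← Complex.ofReal_mul,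
    ← Complex.ofReal_sub, Complex.ofReal_re]

/-- Weyl bounds for the sorted eigenvalues of `B = v v^H − β E`, where `E` is a real
diagonal PSD matrix with decreasingly sorted diagonal entries `e₁ ≥ … ≥ e_N ≥ 0`:
`‖v‖² − β e₁ ≤ λ₁ ≤ ‖v‖² − β e_N`, and `−β e_{N−i+1} ≤ λᵢ ≤ −β e_{N−i+2}` for
`2 ≤ i ≤ N` (1-based indexing; `λ` and `e` are 0-indexed in the formal statement). -/
theorem weyl_bounds_rank_one_minus_diagonal
    (N : ℕ) (v : Fin N → ℂ) (β : ℝ) (hβ : 0 < β)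
    (e : Fin N → ℝ) (he : Antitone e) (he0 : ∀ i, 0 ≤ e i)
    (hB : (Matrix.vecMulVec v (star v) -
        ((β : ℝ) : ℂ) • Matrix.diagonal (fun i => ((e i : ℝ) : ℂ))).IsHermitian)
    (lam : Fin N → ℝ) (hlam : Antitone lam)
    (hperm : ∃ σ : Equiv.Perm (Fin N), lam = hB.eigenvalues ∘ σ) :
    (∀ h1 : 0 < N,
      (∑ i, ‖v i‖ ^ 2) - β * e ⟨0, h1⟩ ≤ lam ⟨0, h1⟩ ∧
      lam ⟨0, h1⟩ ≤ (∑ i, ‖v i‖ ^ 2) - β * e ⟨N - 1, by omega⟩) ∧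
    (∀ i : ℕ, ∀ h2 : 2 ≤ i, ∀ hiN : i ≤ N,
      -β * e ⟨N - i, by omega⟩ ≤ lam ⟨i - 1, by omega⟩ ∧
      lam ⟨i - 1, by omega⟩ ≤ -β * e ⟨N - i + 1, by omega⟩) := by
  obtain ⟨σ, rfl⟩ := hperm
  set lam := hB.eigenvalues ∘ σ with hlamdef
  let b := hB.eigenvectorBasis.reindex σ.symm
  have hb : ∀ j, Matrix.toEuclideanLin (Matrix.vecMulVec v (star v) -
      ((β : ℝ) : ℂ) • Matrix.diagonal (fun i => ((e i : ℝ) : ℂ))) (b j) =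
      (lam j : ℂ) • b j := fun j => by
    ext i
    simpa [b, hlamdef, Matrix.toLpLin_apply, -map_sub] using
      congrFun (hB.mulVec_eigenvectorBasis (σ j)) i
  have key (x : EuclideanSpace ℂ (Fin N)) : ∑ j, lam j * ‖⟪b j, x⟫_ℂ‖ ^ 2 =
      ‖⟪WithLp.toLp 2 v, x⟫_ℂ‖ ^ 2 - β * ∑ j, e j * ‖x j‖ ^ 2 := by
    rw [← b.re_inner_apply_eq_sum hb, re_inner_rank_one_sub_diagonal]
  have hvnorm : ∑ i, ‖v i‖ ^ 2 = ‖(WithLp.toLp 2 v : EuclideanSpace ℂ (Fin N))‖ ^ 2 := by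
    rw [EuclideanSpace.norm_sq_eq]
  have upper {c : ℝ} {x : EuclideanSpace ℂ (Fin N)} (h : ∀ j, ⟪b j, x⟫_ℂ ≠ 0 → lam j ≤ c) :
      ∑ j, lam j * ‖⟪b j, x⟫_ℂ‖ ^ 2 ≤ c * ‖x‖ ^ 2 := by
    simpa only [b.sum_sq_norm_inner_right] using sum_mul_sq_norm_le h
  have lower {c : ℝ} {x : EuclideanSpace ℂ (Fin N)} (h : ∀ j, ⟪b j, x⟫_ℂ ≠ 0 → c ≤ lam j) :
      c * ‖x‖ ^ 2 ≤ ∑ j, lam j * ‖⟪b j, x⟫_ℂ‖ ^ 2 := by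
    simpa only [b.sum_sq_norm_inner_right] using le_sum_mul_sq_norm h
  have eupper {c : ℝ} {x : EuclideanSpace ℂ (Fin N)} (h : ∀ j, x j ≠ 0 → e j ≤ c) :
      β * ∑ j, e j * ‖x j‖ ^ 2 ≤ β * (c * ‖x‖ ^ 2) := by
    rw [EuclideanSpace.norm_sq_eq]
    exact mul_le_mul_of_nonneg_left (sum_mul_sq_norm_le h) hβ.le
  have elower {c : ℝ} {x : EuclideanSpace ℂ (Fin N)} (h : ∀ j, x j ≠ 0 → c ≤ e j) :
      β * (c * ‖x‖ ^ 2) ≤ β * ∑ j, e j * ‖x j‖ ^ 2 := by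
    rw [EuclideanSpace.norm_sq_eq]
    exact mul_le_mul_of_nonneg_left (le_sum_mul_sq_norm h) hβ.le
  have pos {x : EuclideanSpace ℂ (Fin N)} (h : x ≠ 0) : 0 < ‖x‖ ^ 2 := by positivity
  refine ⟨fun h1 => ⟨?_, ?_⟩, fun i h2 hiN => ⟨?_, ?_⟩⟩
  · obtain ⟨x, hx0, hx⟩ : ∃ x : EuclideanSpace ℂ (Fin N), x ≠ 0 ∧
        ‖⟪WithLp.toLp 2 v, x⟫_ℂ‖ = ‖(WithLp.toLp 2 v : EuclideanSpace ℂ (Fin N))‖ * ‖x‖ := by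
      by_cases hv : (WithLp.toLp 2 v : EuclideanSpace ℂ (Fin N)) = 0
      · exact ⟨b ⟨0, h1⟩, b.orthonormal.ne_zero _, by simp [hv]⟩
      · exact ⟨_, hv, by rw [inner_self_eq_norm_sq_to_K]; simp [sq]⟩
    have hu := upper (x := x) (c := lam ⟨0, h1⟩) fun j _ => hlam (Fin.mk_le_of_le_val j.1.zero_le)
    have hl := eupper (x := x) (c := e ⟨0, h1⟩) fun j _ => he (Fin.mk_le_of_le_val j.1.zero_le)
    rw [key, hx, mul_pow] at hu
    rw [hvnorm]
    refine le_of_mul_le_mul_right ?_ (pos hx0)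
    linarith
  · have hu := lower (x := b ⟨0, h1⟩) (c := lam ⟨0, h1⟩) fun j hj => by
      rw [b.inner_eq_ite] at hj
      rw [of_not_not fun h => hj (if_neg h)]
    have hl := elower (x := b ⟨0, h1⟩) (c := e ⟨N - 1, by omega⟩) fun j _ =>
      he (Fin.le_def.mpr (by simp; omega))
    have hcs := pow_le_pow_left₀ (norm_nonneg _)
      (norm_inner_le_norm (𝕜 := ℂ) (WithLp.toLp 2 v) (b ⟨0, h1⟩)) 2
    rw [key] at hu
    rw [b.norm_eq_one] at hu hl hcs
    rw [hvnorm]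
    linarith
  · obtain ⟨x, hx0, hx⟩ := exists_ne_zero_forall_dual_eq_zero (K := ℂ)
      (V := EuclideanSpace ℂ (Fin N))
      (Sum.elim (fun j : Fin (i - 1) => (innerSL ℂ (b ⟨j, by omega⟩)).toLinearMap)
        (fun j : Fin (N - i) => (EuclideanSpace.proj (𝕜 := ℂ) (⟨j, by omega⟩ : Fin N)).toLinearMap))
      (by simp; omega)
    have hu := upper (x := x) (c := lam ⟨i - 1, by omega⟩) fun j hj =>
      hlam (Fin.le_def.mpr (not_lt.mp fun h => hj (hx (.inl ⟨j, h⟩))))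
    have hl := eupper (x := x) (c := e ⟨N - i, by omega⟩) fun j hj =>
      he (Fin.le_def.mpr (not_lt.mp fun h => hj (hx (.inr ⟨j, h⟩))))
    rw [key] at hu
    refine le_of_mul_le_mul_right ?_ (pos hx0)
    linarith [sq_nonneg ‖⟪WithLp.toLp 2 v, x⟫_ℂ‖]
  · obtain ⟨x, hx0, hx⟩ := exists_ne_zero_forall_dual_eq_zero (K := ℂ)
      (V := EuclideanSpace ℂ (Fin N))
      (Sum.elim (fun j : Fin (N - i) => (innerSL ℂ (b ⟨i + j, by omega⟩)).toLinearMap)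
        (Sum.elim
          (fun j : Fin (i - 2) =>
            (EuclideanSpace.proj (𝕜 := ℂ) (⟨N - i + 2 + j, by omega⟩ : Fin N)).toLinearMap)
          (fun _ : Unit => (innerSL ℂ (WithLp.toLp 2 v)).toLinearMap)))
      (by simp; omega)
    have hu := lower (x := x) (c := lam ⟨i - 1, by omega⟩) fun j hj => by
      refine hlam (Fin.le_def.mpr (not_lt.mp fun h => hj ?_))
      obtain ⟨j, hjN⟩ := j
      obtain ⟨k, rfl⟩ := Nat.exists_eq_add_of_le (show i ≤ j by simp at h; omega)
      exact hx (.inl ⟨k, by omega⟩)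
    have hl := elower (x := x) (c := e ⟨N - i + 1, by omega⟩) fun j hj => by
      refine he (Fin.le_def.mpr (not_lt.mp fun h => hj ?_))
      obtain ⟨j, hjN⟩ := j
      obtain ⟨k, rfl⟩ := Nat.exists_eq_add_of_le (show N - i + 2 ≤ j by simp at h; omega)
      exact hx (.inr (.inl ⟨k, by omega⟩))
    have hv : ⟪WithLp.toLp 2 v, x⟫_ℂ = 0 := hx (.inr (.inr ()))
    rw [key, hv, norm_zero] at hu
    refine le_of_mul_le_mul_right ?_ (pos hx0)
    linarith
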